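/- Let (A, φ, V, f, Φ) be a non-commutative probability space of type B and let (a, ξ) ∈ A × V. Let M(z) = Σ_{n≥1} E((a,ξ)ⁿ) zⁿ be the moment series and R(z) = Σ_{n≥1} κ^B_n((a,ξ),...,(a,ξ)) zⁿ the R-transform of (a,ξ). Then M = R ⊛^B ζ', where ζ' ∈ Θ^B is the series ζ'(z) = Σ_{n≥1} (1,0) zⁿ. -/

import Mathlib

open scoped Classical

namespace NCPB

/-- A collection of subsets of `α` is a partition: blocks are nonempty and
every element lies in exactly one block. -/
def IsPartition {α : Type*} (P : Set (Set α)) : Prop :=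
  (∀ B ∈ P, B.Nonempty) ∧ ∀ a : α, ∃! B, B ∈ P ∧ a ∈ B

/-- The non-crossing condition for a collection of subsets of a linear order:
if `a < b < c < d`, `a, c` lie in a block `B` and `b, d` lie in a block `C`,
then `b ∈ B` (i.e. the blocks coincide). -/
def IsNC {α : Type*} [LinearOrder α] (P : Set (Set α)) : Prop :=
  ∀ B ∈ P, ∀ C ∈ P, ∀ a b c d : α, a < b → b < c → c < d →
    a ∈ B → c ∈ B → b ∈ C → d ∈ C → b ∈ B

/-- A non-crossing partition of a linear order. -/
def NCPart {α : Type*} [LinearOrder α] (P : Set (Set α)) : Prop :=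
  IsPartition P ∧ IsNC P

/-- The set `[±m] = {1 < 2 < ... < m < -1 < -2 < ... < -m}` is encoded as `Fin (2*m)`,
position `k < m` encoding `k+1` and position `m + j` encoding `-(j+1)`.
`negMap` is the inversion map `a ↦ -a`. -/
def negMap (m : ℕ) (k : Fin (2*m)) : Fin (2*m) :=
  ⟨(k.val + m) % (2*m), Nat.mod_lt _ (Nat.lt_of_le_of_lt (Nat.zero_le _) k.isLt)⟩

/-- Image of a subset of `[±m]` under the inversion map, i.e. `X ↦ -X`. -/
def negSet (m : ℕ) (X : Set (Fin (2*m))) : Set (Fin (2*m)) := negMap m '' X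

/-- The absolute value map `[±m] → {1,...,m}`, `±i ↦ i`. -/
def absMap (m : ℕ) (k : Fin (2*m)) : Fin m :=
  ⟨k.val % m, Nat.mod_lt _ (by have := k.isLt; omega)⟩

/-- A non-crossing partition of type B: a non-crossing partition of `[±m]`
invariant under the inversion map. -/
def NCBPart (m : ℕ) (π : Set (Set (Fin (2*m)))) : Prop :=
  NCPart π ∧ ∀ B ∈ π, negSet m B ∈ π

/-- The collection of sets `Abs(X)`, `X` a block of `π`. -/
def absPart (m : ℕ) (π : Set (Set (Fin (2*m)))) : Set (Set (Fin m)) :=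
  {F | ∃ X ∈ π, F = absMap m '' X}

/-- The embedding of `{1,...,m}` onto the odd-indexed positions of the interleaved
set `1 < 1̄ < 2 < 2̄ < ... < m < m̄` (encoded as `Fin (2*m)`): `i ↦ i` (even positions). -/
def evens (m : ℕ) (i : Fin m) : Fin (2*m) := ⟨2*i.val, by have := i.isLt; omega⟩

/-- The embedding of the barred copy `{1̄,...,m̄}` into the interleaved set: odd positions. -/
def odds (m : ℕ) (i : Fin m) : Fin (2*m) := ⟨2*i.val+1, by have := i.isLt; omega⟩

/-- `P` refines... rather: every block of `P` is contained in a block of `Q`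
(the partial order on partitions by reverse refinement: `P ≤ Q`). -/
def Refines {α : Type*} (P Q : Set (Set α)) : Prop := ∀ B ∈ P, ∃ C ∈ Q, B ⊆ C

/-- The collection `p ∪ q̄` of subsets of the interleaved set
`1 < 1̄ < 2 < 2̄ < ... < m < m̄`, with `p` living on the unbarred copy and `q` on the
barred copy. -/
def interleave (m : ℕ) (p q : Set (Set (Fin m))) : Set (Set (Fin (2*m))) :=
  ((fun B => evens m '' B) '' p) ∪ ((fun B => odds m '' B) '' q)

/-- `q` is the Kreweras complement of `p`: `q` is the largest non-crossing partition
(in the reverse-refinement order) such that `p ∪ q̄` is a non-crossing partition of the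
interleaved set `1 < 1̄ < ... < m < m̄`. -/
def IsKr (m : ℕ) (p q : Set (Set (Fin m))) : Prop :=
  NCPart q ∧ NCPart (interleave m p q) ∧
  ∀ q', NCPart q' → NCPart (interleave m p q') → Refines q' q

/-- Two sets cross: there are `a < b < c < d` with `a, c ∈ B` and `b, d ∈ C`. -/
def Crossing {α : Type*} [LinearOrder α] (B C : Set α) : Prop :=
  ∃ a b c d : α, a < b ∧ b < c ∧ c < d ∧ a ∈ B ∧ c ∈ B ∧ b ∈ C ∧ d ∈ C

/-- Two members of a non-crossing family of pairwise disjoint sets: disjoint,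
and neither crosses the other. -/
def PairNC {α : Type*} [LinearOrder α] (B C : Set α) : Prop :=
  Disjoint B C ∧ ¬ Crossing B C ∧ ¬ Crossing C B

end NCPB
namespace NCPB

/-- `X` is the chosen representative of the pair of blocks `{X, -X}`:
the least element of `X ∪ (-X)` lies in `X`. -/
def IsRep (m : ℕ) (X : Set (Fin (2*m))) : Prop :=
  ∃ x, IsLeast (X ∪ negSet m X) x ∧ x ∈ X

/-- The first component `γ'_m` of the coefficients of the boxed convolution of type B:
a summation over `NC^A(m)` (each `p` paired with its Kreweras complement). -/
noncomputable def gammaFst (a' b' : ℕ → ℂ) (m : ℕ) : ℂ :=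
  ∑ᶠ (pq : Set (Set (Fin m)) × Set (Set (Fin m)))
    (_ : NCPart pq.1 ∧ IsKr m pq.1 pq.2),
    (∏ᶠ F ∈ pq.1, a' F.ncard) * (∏ᶠ E ∈ pq.2, b' E.ncard)

/-- The second component `γ''_m` of the coefficients of the boxed convolution of type B:
a summation over `NC^B(m)`, split according to whether `π` or `Kr(π)` has the
zero-block `Z` (the third component of the summation variable `t`). The products run
over a choice of one block out of each pair `{X, -X}` of non-zero-blocks. -/
noncomputable def gammaSnd (a' a'' b' b'' : ℕ → ℂ) (m : ℕ) : ℂ :=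
  (∑ᶠ (t : (Set (Set (Fin (2*m))) × Set (Set (Fin (2*m)))) × Set (Fin (2*m)))
    (_ : NCBPart m t.1.1 ∧ IsKr (2*m) t.1.1 t.1.2 ∧ t.2 ∈ t.1.1 ∧ negSet m t.2 = t.2),
    (∏ᶠ X ∈ {X | X ∈ t.1.1 ∧ negSet m X ≠ X ∧ IsRep m X}, a' X.ncard) *
      a'' (t.2.ncard / 2) *
      (∏ᶠ Y ∈ {Y | Y ∈ t.1.2 ∧ negSet m Y ≠ Y ∧ IsRep m Y}, b' Y.ncard))
  +
  (∑ᶠ (t : (Set (Set (Fin (2*m))) × Set (Set (Fin (2*m)))) × Set (Fin (2*m)))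
    (_ : NCBPart m t.1.1 ∧ (¬ ∃ Z ∈ t.1.1, negSet m Z = Z) ∧
         IsKr (2*m) t.1.1 t.1.2 ∧ t.2 ∈ t.1.2 ∧ negSet m t.2 = t.2),
    (∏ᶠ X ∈ {X | X ∈ t.1.1 ∧ negSet m X ≠ X ∧ IsRep m X}, a' X.ncard) *
      b'' (t.2.ncard / 2) *
      (∏ᶠ Y ∈ {Y | Y ∈ t.1.2 ∧ negSet m Y ≠ Y ∧ IsRep m Y}, b' Y.ncard))

/-- An element of `ℂ²`, regarded as an element of the algebra
`C = ℂ[x]/(x²)` (realized as the dual numbers over `ℂ`). -/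
noncomputable def mkD (x y : ℂ) : DualNumber ℂ :=
  TrivSqZeroExt.inl x + TrivSqZeroExt.inr y

/-- A series `Σ_{n ≥ 1} (α_n', α_n'') zⁿ` of `Θ^B` is encoded as the function
`ℕ → ℂ²` sending `k` to the coefficient of `z^(k+1)`.  `boxedB f g` is the boxed
convolution of type B, `f ⊛^B g`. -/
noncomputable def boxedB (f g : ℕ → DualNumber ℂ) : ℕ → DualNumber ℂ :=
  fun k => mkD
    (gammaFst (fun j => (f (j-1)).fst) (fun j => (g (j-1)).fst) (k+1))
    (gammaSnd (fun j => (f (j-1)).fst) (fun j => (f (j-1)).snd)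
              (fun j => (g (j-1)).fst) (fun j => (g (j-1)).snd) (k+1))

/-- The series `Δ'(z) = (1,0) z`. -/
noncomputable def deltaB : ℕ → DualNumber ℂ := fun k => if k = 0 then 1 else 0

/-- The boxed convolution of type A with coefficients in a commutative unital
algebra `C` (series encoded as in `boxedB`: index `k` holds the coefficient
of `z^(k+1)`). -/
noncomputable def boxedA {C : Type*} [CommRing C] (f g : ℕ → C) : ℕ → C :=
  fun k =>
    ∑ᶠ (pq : Set (Set (Fin (k+1))) × Set (Set (Fin (k+1))))
      (_ : NCPart pq.1 ∧ IsKr (k+1) pq.1 pq.2),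
      (∏ᶠ F ∈ pq.1, f (F.ncard - 1)) * (∏ᶠ E ∈ pq.2, g (E.ncard - 1))

end NCPB
namespace NCPB

/-- The order-preserving enumeration of a subset `F` of `Fin N`. -/
noncomputable def enumSet {N : ℕ} (F : Set (Fin N)) (i : Fin F.ncard) : Fin N :=
  ((Set.toFinite F).toFinset.orderIsoOfFin
    (Set.ncard_eq_toFinset_card F (Set.toFinite F)).symm i).val

/-- The position of an element `j ∈ F` in the order-preserving enumeration of `F`. -/
noncomputable def idxIn {N : ℕ} (F : Set (Fin N)) (j : Fin N) (hj : j ∈ F) :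
    Fin F.ncard :=
  ((Set.toFinite F).toFinset.orderIsoOfFin
    (Set.ncard_eq_toFinset_card F (Set.toFinite F)).symm).symm
    ⟨j, (Set.Finite.mem_toFinset _).2 hj⟩

section NCPSB

variable (A : Type*) [Ring A] [Algebra ℂ A]
variable (V : Type*) [AddCommGroup V] [Module ℂ V]
variable [Module A V] [Module Aᵐᵒᵖ V] [SMulCommClass A Aᵐᵒᵖ V]

/-- The expectation `E : A × V → ℂ²` of a non-commutative probability space of type B,
on the linking algebra `A × V` (realized as `TrivSqZeroExt A V`, whose multiplication
is `(a,ξ)(b,η) = (ab, aη + ξb)`), with values in the algebra `ℂ²` (realized as the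
dual numbers, whose multiplication is `(α',α'')(β',β'') = (α'β', α'β'' + α''β')`). -/
noncomputable def expB (φ : A →ₗ[ℂ] ℂ) (f : V →ₗ[ℂ] ℂ) (x : TrivSqZeroExt A V) :
    DualNumber ℂ :=
  mkD (φ x.fst) (f x.snd)

/-- The family `κ^A_n : Aⁿ → ℂ` satisfies the moment-cumulant formula of type A:
`Σ_{p ∈ NC^A(n)} Π_{F block of p} κ^A_{|F|}((a₁,...,a_n)|F) = φ(a₁⋯a_n)` for `n ≥ 1`. -/
def MomCumA (φ : A →ₗ[ℂ] ℂ) (κA : (m : ℕ) → (Fin m → A) → ℂ) : Prop :=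
  ∀ (N : ℕ) (a : Fin (N+1) → A),
    (∑ᶠ (p : Set (Set (Fin (N+1)))) (_ : NCPart p),
      ∏ᶠ F ∈ p, κA F.ncard (fun i => a (enumSet F i))) = φ (List.ofFn a).prod

/-- The family `κ^{A'}_{n;m}` (with `m`-th argument a vector of `V`, encoded as
`κA' n a j ξ`, the entry `a j` being irrelevant) satisfies the moment-cumulant formula
of type A': for every position `j` of the vector,
`Σ_{p ∈ NC^A(n)} Π_{F block of p} κ^{A'}_{|F|}(...|F) = f(a₁ ⋯ a_{j-1} ξ a_{j+1} ⋯ a_n)`,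
where within each block one uses `κ^{A'}` if the block contains `j` and `κ^A` otherwise. -/
def MomCumA' (f : V →ₗ[ℂ] ℂ) (κA : (m : ℕ) → (Fin m → A) → ℂ)
    (κA' : (m : ℕ) → (Fin m → A) → Fin m → V → ℂ) : Prop :=
  (∀ (m : ℕ) (a a₀ : Fin m → A) (j : Fin m) (ξ : V),
      (∀ l, l ≠ j → a l = a₀ l) → κA' m a j ξ = κA' m a₀ j ξ) ∧
  ∀ (N : ℕ) (a : Fin (N+1) → A) (j : Fin (N+1)) (ξ : V),
    (∑ᶠ (p : Set (Set (Fin (N+1)))) (_ : NCPart p),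
      ∏ᶠ F ∈ p,
        (if h : j ∈ F then κA' F.ncard (fun i => a (enumSet F i)) (idxIn F j h) ξ
         else κA F.ncard (fun i => a (enumSet F i)))) =
    f ((List.ofFn (fun i => if i = j then (TrivSqZeroExt.inr ξ : TrivSqZeroExt A V)
          else TrivSqZeroExt.inl (a i))).prod).snd

/-- The family `κ^B_n : (A × V)ⁿ → ℂ²` satisfies the moment-cumulant formula of type B:
`Σ_{p ∈ NC^A(n)} Π_{F block of p} κ^B_{|F|}(((a₁,ξ₁),...,(a_n,ξ_n))|F)
  = E((a₁,ξ₁)⋯(a_n,ξ_n))` for `n ≥ 1`, the products over blocks being taken in the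
algebra `ℂ²`. -/
def MomCumB (φ : A →ₗ[ℂ] ℂ) (f : V →ₗ[ℂ] ℂ)
    (κB : (m : ℕ) → (Fin m → TrivSqZeroExt A V) → DualNumber ℂ) : Prop :=
  ∀ (N : ℕ) (x : Fin (N+1) → TrivSqZeroExt A V),
    (∑ᶠ (p : Set (Set (Fin (N+1)))) (_ : NCPart p),
      ∏ᶠ F ∈ p, κB F.ncard (fun i => x (enumSet F i))) =
    expB A V φ f (List.ofFn x).prod

end NCPSB

end NCPB

namespace NCPB

section Partitions

variable {α : Type*}

/-- Two points lie in a common member of the family `P`. -/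
def SameBlock (P : Set (Set α)) (x y : α) : Prop := ∃ B ∈ P, x ∈ B ∧ y ∈ B

/-- The family of classes of a relation. -/
def classesOf (r : α → α → Prop) : Set (Set α) := {B | ∃ x, B = {y | r x y}}

theorem IsPartition.eq_of_mem {P : Set (Set α)} (h : IsPartition P) {B C : Set α} {x : α}
    (hB : B ∈ P) (hC : C ∈ P) (hxB : x ∈ B) (hxC : x ∈ C) : B = C :=
  (h.2 x).unique ⟨hB, hxB⟩ ⟨hC, hxC⟩

theorem IsPartition.exists_mem {P : Set (Set α)} (h : IsPartition P) (x : α) :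
    ∃ B ∈ P, x ∈ B := by
  obtain ⟨B, hB, -⟩ := h.2 x
  exact ⟨B, hB⟩

theorem SameBlock.symm {P : Set (Set α)} {x y : α} (h : SameBlock P x y) : SameBlock P y x := by
  obtain ⟨B, hB, hx, hy⟩ := h
  exact ⟨B, hB, hy, hx⟩

theorem IsPartition.sameBlock_refl {P : Set (Set α)} (h : IsPartition P) (x : α) :
    SameBlock P x x := by
  obtain ⟨B, hB, hx⟩ := h.exists_mem x
  exact ⟨B, hB, hx, hx⟩

theorem IsPartition.sameBlock_iff {P : Set (Set α)} (h : IsPartition P) {B : Set α} {x y : α}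
    (hB : B ∈ P) (hx : x ∈ B) : SameBlock P x y ↔ y ∈ B := by
  constructor
  · rintro ⟨C, hC, hxC, hyC⟩
    rwa [h.eq_of_mem hB hC hx hxC]
  · exact fun hy => ⟨B, hB, hx, hy⟩

theorem IsPartition.sameBlock_trans {P : Set (Set α)} (h : IsPartition P) {x y z : α}
    (hxy : SameBlock P x y) (hyz : SameBlock P y z) : SameBlock P x z := by
  obtain ⟨B, hB, hx, hy⟩ := hxy
  exact ⟨B, hB, hx, (h.sameBlock_iff hB hy).1 hyz⟩

theorem IsPartition.subset_of_sameBlock {P Q : Set (Set α)} (hP : IsPartition P)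
    (hQ : IsPartition Q) (h : ∀ x y, SameBlock P x y ↔ SameBlock Q x y) : P ⊆ Q := by
  intro B hB
  obtain ⟨x, hx⟩ := hP.1 B hB
  obtain ⟨C, hC, hxC⟩ := hQ.exists_mem x
  have : B = C := by
    ext y
    rw [← hP.sameBlock_iff hB hx, h, hQ.sameBlock_iff hC hxC]
  rwa [this]

theorem IsPartition.ext_sameBlock {P Q : Set (Set α)} (hP : IsPartition P) (hQ : IsPartition Q)
    (h : ∀ x y, SameBlock P x y ↔ SameBlock Q x y) : P = Q :=
  (hP.subset_of_sameBlock hQ h).antisymm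
    (hQ.subset_of_sameBlock hP fun x y => (h x y).symm)

theorem isPartition_classesOf {r : α → α → Prop} (hr : Equivalence r) :
    IsPartition (classesOf r) := by
  refine ⟨?_, fun x => ⟨{y | r x y}, ⟨⟨x, rfl⟩, hr.refl x⟩, ?_⟩⟩
  · rintro _ ⟨x, rfl⟩
    exact ⟨x, hr.refl x⟩
  · rintro _ ⟨⟨z, rfl⟩, hz⟩
    ext y
    exact ⟨fun h => hr.trans (hr.symm hz) h, fun h => hr.trans hz h⟩

theorem sameBlock_classesOf {r : α → α → Prop} (hr : Equivalence r) (x y : α) :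
    SameBlock (classesOf r) x y ↔ r x y :=
  (isPartition_classesOf hr).sameBlock_iff ⟨x, rfl⟩ (hr.refl x)

theorem IsPartition.isNC_iff [LinearOrder α] {P : Set (Set α)} (h : IsPartition P) :
    IsNC P ↔ ∀ a b c d : α, a < b → b < c → c < d →
      SameBlock P a c → SameBlock P b d → SameBlock P a b := by
  constructor
  · rintro hP a b c d hab hbc hcd ⟨B, hB, ha, hc⟩ ⟨C, hC, hb, hd⟩
    exact ⟨B, hB, ha, hP B hB C hC a b c d hab hbc hcd ha hc hb hd⟩
  · intro hP B hB C hC a b c d hab hbc hcd ha hc hb hd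
    exact (h.sameBlock_iff hB ha).1
      (hP a b c d hab hbc hcd ⟨B, hB, ha, hc⟩ ⟨C, hC, hb, hd⟩)

theorem Refines.eq_of_isPartition {P Q : Set (Set α)} (hP : IsPartition P) (hQ : IsPartition Q)
    (hPQ : Refines P Q) (hQP : Refines Q P) : P = Q := by
  refine hP.ext_sameBlock hQ fun x y => ⟨?_, ?_⟩
  · rintro ⟨B, hB, hx, hy⟩
    obtain ⟨C, hC, hBC⟩ := hPQ B hB
    exact ⟨C, hC, hBC hx, hBC hy⟩
  · rintro ⟨B, hB, hx, hy⟩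
    obtain ⟨C, hC, hBC⟩ := hQP B hB
    exact ⟨C, hC, hBC hx, hBC hy⟩

end Partitions

section Kreweras

variable {m : ℕ}

/-- No block of `p` separates the barred points `ī` and `j̄` of the interleaved set. -/
def krRel (p : Set (Set (Fin m))) (i j : Fin m) : Prop :=
  ∀ B ∈ p, ∀ b ∈ B, ∀ b' ∈ B, ((b ≤ i ↔ b' ≤ i) ↔ (b ≤ j ↔ b' ≤ j))

theorem equivalence_krRel (p : Set (Set (Fin m))) : Equivalence (krRel p) where
  refl _ _ _ _ _ _ _ := Iff.rfl
  symm h B hB b hb b' hb' := (h B hB b hb b' hb').symm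
  trans h h' B hB b hb b' hb' := (h B hB b hb b' hb').trans (h' B hB b hb b' hb')

theorem evens_ne_odds (i j : Fin m) : evens m i ≠ odds m j := by
  simp only [evens, odds, ne_eq, Fin.mk.injEq]
  omega

theorem evens_injective : Function.Injective (evens m) := by
  intro i j h
  simp only [evens, Fin.mk.injEq] at h
  exact Fin.ext (by omega)

theorem odds_injective : Function.Injective (odds m) := by
  intro i j h
  simp only [odds, Fin.mk.injEq] at h
  exact Fin.ext (by omega)

theorem eq_evens_or_odds (x : Fin (2*m)) : (∃ i, x = evens m i) ∨ ∃ i, x = odds m i := by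
  have := x.isLt
  rcases Nat.even_or_odd' x.val with ⟨c, hc | hc⟩
  · exact Or.inl ⟨⟨c, by omega⟩, Fin.ext hc⟩
  · exact Or.inr ⟨⟨c, by omega⟩, Fin.ext hc⟩

theorem isPartition_interleave {p q : Set (Set (Fin m))} (hp : IsPartition p)
    (hq : IsPartition q) : IsPartition (interleave m p q) := by
  refine ⟨?_, fun x => ?_⟩
  · rintro _ (⟨B, hB, rfl⟩ | ⟨B, hB, rfl⟩)
    · exact (hp.1 B hB).image _
    · exact (hq.1 B hB).image _
  · rcases eq_evens_or_odds x with ⟨i, rfl⟩ | ⟨i, rfl⟩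
    · obtain ⟨B, hB, hi⟩ := hp.exists_mem i
      refine ⟨evens m '' B, ⟨Or.inl ⟨B, hB, rfl⟩, ⟨i, hi, rfl⟩⟩, ?_⟩
      rintro _ ⟨⟨C, hC, rfl⟩ | ⟨C, hC, rfl⟩, ⟨j, hj, hji⟩⟩
      · rw [evens_injective hji] at hj
        rw [hp.eq_of_mem hB hC hi hj]
      · exact absurd hji.symm (evens_ne_odds _ _)
    · obtain ⟨B, hB, hi⟩ := hq.exists_mem i
      refine ⟨odds m '' B, ⟨Or.inr ⟨B, hB, rfl⟩, ⟨i, hi, rfl⟩⟩, ?_⟩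
      rintro _ ⟨⟨C, hC, rfl⟩ | ⟨C, hC, rfl⟩, ⟨j, hj, hji⟩⟩
      · exact absurd hji (evens_ne_odds _ _)
      · rw [odds_injective hji] at hj
        rw [hq.eq_of_mem hB hC hi hj]

theorem nCPart_classesOf_krRel (p : Set (Set (Fin m))) : NCPart (classesOf (krRel p)) := by
  have hq := isPartition_classesOf (equivalence_krRel p)
  refine ⟨hq, hq.isNC_iff.2 fun a b c d hab hbc hcd hac hbd => ?_⟩
  rw [sameBlock_classesOf (equivalence_krRel p)] at *
  intro B hB x hx y hy
  have h1 := hac B hB x hx y hy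
  have h2 := hbd B hB x hx y hy
  simp only [Fin.le_def, Fin.lt_def] at *
  omega

theorem nCPart_interleave_krRel {p : Set (Set (Fin m))} (hp : NCPart p) :
    NCPart (interleave m p (classesOf (krRel p))) := by
  have hq := nCPart_classesOf_krRel p
  have hr := equivalence_krRel p
  refine ⟨isPartition_interleave hp.1 hq.1, ?_⟩
  rintro _ (⟨B, hB, rfl⟩ | ⟨B, hB, rfl⟩) _ (⟨C, hC, rfl⟩ | ⟨C, hC, rfl⟩)
    _ _ _ _ hab hbc hcd ⟨a, ha, rfl⟩ ⟨c, hc, rfl⟩ ⟨b, hb, rfl⟩ ⟨d, hd, rfl⟩ <;>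
    simp only [evens, odds, Fin.lt_def] at hab hbc hcd
  · refine ⟨b, hp.2 B hB C hC a b c d ?_ ?_ ?_ ha hc hb hd, rfl⟩ <;>
      rw [Fin.lt_def] <;> omega
  · have h := (sameBlock_classesOf hr b d).1 ⟨C, hC, hb, hd⟩ B hB a ha c hc
    simp only [Fin.le_def] at h
    omega
  · have h := (sameBlock_classesOf hr a c).1 ⟨B, hB, ha, hc⟩ C hC b hb d hd
    simp only [Fin.le_def] at h
    omega
  · refine ⟨b, hq.2 B hB C hC a b c d ?_ ?_ ?_ ha hc hb hd, rfl⟩ <;>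
      rw [Fin.lt_def] <;> omega

theorem refines_classesOf_krRel {p q : Set (Set (Fin m))} (hq : IsPartition q)
    (h : IsNC (interleave m p q)) : Refines q (classesOf (krRel p)) := by
  have key : ∀ C ∈ q, ∀ i ∈ C, ∀ j ∈ C, i < j → krRel p i j := by
    intro C hC i hi j hj hij B hB b hb b' hb'
    have hB' : evens m '' B ∈ interleave m p q := Or.inl ⟨B, hB, rfl⟩
    have hC' : odds m '' C ∈ interleave m p q := Or.inr ⟨C, hC, rfl⟩
    have h₁ : ∀ x ∈ B, ∀ y ∈ B, ¬ (x ≤ i ∧ i < y ∧ y ≤ j) := by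
      rintro x hx y hy ⟨hxi, hiy, hyj⟩
      obtain ⟨z, -, hz⟩ := h _ hB' _ hC' (evens m x) (odds m i) (evens m y) (odds m j)
        (by simp only [evens, odds, Fin.lt_def, Fin.le_def] at *; omega)
        (by simp only [evens, odds, Fin.lt_def, Fin.le_def] at *; omega)
        (by simp only [evens, odds, Fin.lt_def, Fin.le_def] at *; omega)
        ⟨x, hx, rfl⟩ ⟨y, hy, rfl⟩ ⟨i, hi, rfl⟩ ⟨j, hj, rfl⟩
      exact evens_ne_odds _ _ hz
    have h₂ : ∀ x ∈ B, ∀ y ∈ B, ¬ (i < x ∧ x ≤ j ∧ j < y) := by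
      rintro x hx y hy ⟨hix, hxj, hjy⟩
      obtain ⟨z, -, hz⟩ := h _ hC' _ hB' (odds m i) (evens m x) (odds m j) (evens m y)
        (by simp only [evens, odds, Fin.lt_def, Fin.le_def] at *; omega)
        (by simp only [evens, odds, Fin.lt_def, Fin.le_def] at *; omega)
        (by simp only [evens, odds, Fin.lt_def, Fin.le_def] at *; omega)
        ⟨i, hi, rfl⟩ ⟨j, hj, rfl⟩ ⟨x, hx, rfl⟩ ⟨y, hy, rfl⟩
      exact evens_ne_odds _ _ hz.symm
    have e₁ := h₁ b hb b' hb'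
    have e₂ := h₁ b' hb' b hb
    have e₃ := h₂ b hb b' hb'
    have e₄ := h₂ b' hb' b hb
    simp only [Fin.le_def, Fin.lt_def] at *
    omega
  intro C hC
  obtain ⟨i, hi⟩ := hq.1 C hC
  refine ⟨_, ⟨i, rfl⟩, fun j hj => ?_⟩
  rcases lt_trichotomy i j with hij | rfl | hij
  · exact key C hC i hi j hj hij
  · exact (equivalence_krRel p).refl i
  · exact (equivalence_krRel p).symm (key C hC j hj i hi hij)

theorem isKr_iff {p q : Set (Set (Fin m))} (hp : NCPart p) :
    IsKr m p q ↔ q = classesOf (krRel p) := by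
  have hkr : IsKr m p (classesOf (krRel p)) :=
    ⟨nCPart_classesOf_krRel p, nCPart_interleave_krRel hp,
      fun q' hq' h => refines_classesOf_krRel hq'.1 h.2⟩
  refine ⟨fun h => ?_, fun h => h ▸ hkr⟩
  exact Refines.eq_of_isPartition h.1.1 hkr.1.1 (hkr.2.2 q h.1 h.2.1) (h.2.2 _ hkr.1 hkr.2.1)

end Kreweras

section TypeB

variable {m : ℕ}

/-- The positive preimage of a point under the absolute value map. -/
def posLift (u : Fin m) : Fin (2*m) := ⟨u.val, by omega⟩

/-- The negative preimage of a point under the absolute value map. -/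
def negLift (u : Fin m) : Fin (2*m) := ⟨u.val + m, by omega⟩

theorem absMap_posLift (u : Fin m) : absMap m (posLift u) = u :=
  Fin.ext (Nat.mod_eq_of_lt u.isLt)

theorem absMap_negLift (u : Fin m) : absMap m (negLift u) = u :=
  Fin.ext (by simp [absMap, negLift, Nat.mod_eq_of_lt u.isLt])

theorem negMap_posLift (u : Fin m) : negMap m (posLift u) = negLift u :=
  Fin.ext (Nat.mod_eq_of_lt (by simp only [posLift]; omega))

theorem negMap_negLift (u : Fin m) : negMap m (negLift u) = posLift u := by
  refine Fin.ext ?_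
  simp only [negMap, negLift, posLift]
  rw [show u.val + m + m = u.val + 2 * m by ring, Nat.add_mod_right]
  exact Nat.mod_eq_of_lt (by omega)

theorem eq_posLift_or_negLift (x : Fin (2*m)) : ∃ u, x = posLift u ∨ x = negLift u := by
  have := x.isLt
  by_cases h : x.val < m
  · exact ⟨⟨x, h⟩, Or.inl rfl⟩
  · exact ⟨⟨x - m, by omega⟩, Or.inr (Fin.ext (by simp only [negLift]; omega))⟩

theorem negMap_negMap (x : Fin (2*m)) : negMap m (negMap m x) = x := by
  obtain ⟨u, rfl | rfl⟩ := eq_posLift_or_negLift x <;>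
    simp only [negMap_posLift, negMap_negLift]

theorem absMap_negMap (x : Fin (2*m)) : absMap m (negMap m x) = absMap m x := by
  obtain ⟨u, rfl | rfl⟩ := eq_posLift_or_negLift x <;>
    simp only [negMap_posLift, negMap_negLift, absMap_posLift, absMap_negLift]

theorem absMap_eq_iff {x y : Fin (2*m)} :
    absMap m x = absMap m y ↔ x = y ∨ x = negMap m y := by
  refine ⟨fun h => ?_, ?_⟩
  · obtain ⟨u, rfl | rfl⟩ := eq_posLift_or_negLift x <;>
      obtain ⟨v, rfl | rfl⟩ := eq_posLift_or_negLift y <;>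
      simp only [absMap_posLift, absMap_negLift] at h <;> subst h <;>
      simp [negMap_posLift, negMap_negLift]
  · rintro (rfl | rfl)
    · rfl
    · exact absMap_negMap y

theorem mem_negSet {X : Set (Fin (2*m))} {x : Fin (2*m)} :
    x ∈ negSet m X ↔ negMap m x ∈ X := by
  constructor
  · rintro ⟨y, hy, rfl⟩
    rwa [negMap_negMap]
  · exact fun h => ⟨_, h, negMap_negMap x⟩

theorem negSet_negSet (X : Set (Fin (2*m))) : negSet m (negSet m X) = X := by
  ext x
  rw [mem_negSet, mem_negSet, negMap_negMap]

theorem absMap_image_negSet (X : Set (Fin (2*m))) :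
    absMap m '' negSet m X = absMap m '' X := by
  rw [negSet, Set.image_image]
  simp only [absMap_negMap]

theorem NCBPart.sameBlock_neg {π : Set (Set (Fin (2*m)))} (h : NCBPart m π) {x y : Fin (2*m)}
    (hxy : SameBlock π x y) : SameBlock π (negMap m x) (negMap m y) := by
  obtain ⟨B, hB, hx, hy⟩ := hxy
  exact ⟨_, h.2 B hB, ⟨x, hx, rfl⟩, ⟨y, hy, rfl⟩⟩

theorem NCBPart.eq_or_eq_negSet {π : Set (Set (Fin (2*m)))} (h : NCBPart m π)
    {X Y : Set (Fin (2*m))} (hX : X ∈ π) (hY : Y ∈ π) {u : Fin m}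
    (huX : u ∈ absMap m '' X) (huY : u ∈ absMap m '' Y) : X = Y ∨ X = negSet m Y := by
  obtain ⟨x, hx, rfl⟩ := huX
  obtain ⟨y, hy, hxy⟩ := huY
  rcases absMap_eq_iff.1 hxy with rfl | rfl
  · exact Or.inl (h.1.1.eq_of_mem hX hY hx hy)
  · exact Or.inr (h.1.1.eq_of_mem hX (h.2 Y hY) hx (mem_negSet.2 hy))

theorem NCBPart.isPartition_absPart {π : Set (Set (Fin (2*m)))} (h : NCBPart m π) :
    IsPartition (absPart m π) := by
  refine ⟨?_, fun u => ?_⟩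
  · rintro _ ⟨X, hX, rfl⟩
    exact (h.1.1.1 X hX).image _
  · obtain ⟨X, hX, hu⟩ := h.1.1.exists_mem (posLift u)
    refine ⟨absMap m '' X, ⟨⟨X, hX, rfl⟩, ⟨_, hu, absMap_posLift u⟩⟩, ?_⟩
    rintro _ ⟨⟨Y, hY, rfl⟩, huY⟩
    rcases h.eq_or_eq_negSet hY hX huY ⟨_, hu, absMap_posLift u⟩ with rfl | rfl
    · rfl
    · exact absMap_image_negSet X

theorem NCBPart.sameBlock_absPart {π : Set (Set (Fin (2*m)))} (h : NCBPart m π)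
    (x y : Fin (2*m)) : SameBlock (absPart m π) (absMap m x) (absMap m y) ↔
      SameBlock π x y ∨ SameBlock π x (negMap m y) := by
  constructor
  · rintro ⟨_, ⟨X, hX, rfl⟩, ⟨x', hx', hx⟩, ⟨y', hy', hy⟩⟩
    have hs : SameBlock π x' y' := ⟨X, hX, hx', hy'⟩
    have hs' := h.sameBlock_neg hs
    rcases absMap_eq_iff.1 hx with rfl | rfl <;> rcases absMap_eq_iff.1 hy with rfl | rfl
    · exact Or.inl hs
    · exact Or.inr hs
    · rw [negMap_negMap] at hs'
      exact Or.inr hs'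
    · rw [negMap_negMap, negMap_negMap] at hs'
      exact Or.inl hs'
  · rintro (⟨X, hX, hx, hy⟩ | ⟨X, hX, hx, hy⟩)
    · exact ⟨_, ⟨X, hX, rfl⟩, ⟨x, hx, rfl⟩, ⟨y, hy, rfl⟩⟩
    · exact ⟨_, ⟨X, hX, rfl⟩, ⟨x, hx, rfl⟩, ⟨_, hy, absMap_negMap y⟩⟩

theorem NCBPart.sameBlock_absPart_posLift {π : Set (Set (Fin (2*m)))} (h : NCBPart m π)
    (u v : Fin m) : SameBlock (absPart m π) u v ↔
      SameBlock π (posLift u) (posLift v) ∨ SameBlock π (posLift u) (negLift v) := by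
  have := h.sameBlock_absPart (posLift u) (posLift v)
  rwa [absMap_posLift, absMap_posLift, negMap_posLift] at this

theorem NCBPart.nCPart_absPart {π : Set (Set (Fin (2*m)))} (h : NCBPart m π) :
    NCPart (absPart m π) := by
  have hp := h.isPartition_absPart
  refine ⟨hp, hp.isNC_iff.2 fun a b c d hab hbc hcd hac hbd => ?_⟩
  have nc := h.1.1.isNC_iff.1 h.1.2
  have lift : ∀ x y, SameBlock π x y → SameBlock (absPart m π) (absMap m x) (absMap m y) :=
    fun x y hxy => (h.sameBlock_absPart x y).2 (Or.inl hxy)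
  rw [Fin.lt_def] at hab hbc hcd
  rcases (h.sameBlock_absPart_posLift a c).1 hac with h₁ | h₁ <;>
    rcases (h.sameBlock_absPart_posLift b d).1 hbd with h₂ | h₂
  · have := lift _ _ (nc _ _ _ _ (by simpa [posLift] using hab) (by simpa [posLift] using hbc)
      (by simpa [posLift] using hcd) h₁ h₂)
    rwa [absMap_posLift, absMap_posLift] at this
  · have := lift _ _ (nc _ _ _ _ (by simpa [posLift] using hab) (by simpa [posLift] using hbc)
      (by simp only [posLift, negLift, Fin.lt_def]; omega) h₁ h₂)
    rwa [absMap_posLift, absMap_posLift] at this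
  · have h₃ := (h.sameBlock_neg h₁).symm
    rw [negMap_posLift, negMap_negLift] at h₃
    have := lift _ _ (nc _ _ _ _ (by simpa [posLift] using hbc) (by simpa [posLift] using hcd)
      (by simp only [posLift, negLift, Fin.lt_def]; omega) h₂ h₃)
    rw [absMap_posLift, absMap_posLift] at this
    exact hp.sameBlock_trans hac this.symm
  · have := lift _ _ (nc _ _ _ _ (by simpa [posLift] using hab)
      (by simp only [posLift, negLift, Fin.lt_def]; omega)
      (by simpa [negLift] using hcd) h₁ h₂)
    rwa [absMap_posLift, absMap_posLift] at this

/-- `x` lies on the arc of `[±m]` from `f` to the predecessor of `-f`. -/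
def OnArc (f : Fin m) (x : Fin (2*m)) : Prop := f.val ≤ x.val ∧ x.val < f.val + m

theorem onArc_negMap (f : Fin m) (x : Fin (2*m)) : OnArc f (negMap m x) ↔ ¬ OnArc f x := by
  obtain ⟨u, rfl | rfl⟩ := eq_posLift_or_negLift x
  · rw [negMap_posLift]
    simp only [OnArc, posLift, negLift]
    omega
  · rw [negMap_negLift]
    simp only [OnArc, posLift, negLift]
    omega

/-- The relation whose classes form the non-crossing partition of type B with absolute value `p`
and zero-block lying over the block `F` of `p`; here `f` is any element of `F`. -/
def liftRel (p : Set (Set (Fin m))) (F : Set (Fin m)) (f : Fin m) (x y : Fin (2*m)) : Prop :=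
  SameBlock p (absMap m x) (absMap m y) ∧ (absMap m x ∈ F ∨ (OnArc f x ↔ OnArc f y))

theorem equivalence_liftRel {p : Set (Set (Fin m))} (hp : IsPartition p) {F : Set (Fin m)}
    (hF : F ∈ p) (f : Fin m) : Equivalence (liftRel p F f) where
  refl x := ⟨hp.sameBlock_refl _, Or.inr Iff.rfl⟩
  symm := by
    rintro x y ⟨h, h'⟩
    refine ⟨h.symm, h'.imp (fun hx => (hp.sameBlock_iff hF hx).1 h) Iff.symm⟩
  trans := by
    rintro x y z ⟨h, h'⟩ ⟨k, k'⟩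
    refine ⟨hp.sameBlock_trans h k, ?_⟩
    rcases h' with h' | h'
    · exact Or.inl h'
    · exact k'.imp (fun hy => (hp.sameBlock_iff hF hy).1 h.symm) h'.trans

theorem NCBPart.sameBlock_iff_liftRel {π : Set (Set (Fin (2*m)))} (h : NCBPart m π)
    {Z : Set (Fin (2*m))} (hZ : Z ∈ π) (hnZ : negSet m Z = Z) {f : Fin m}
    (hf : f ∈ absMap m '' Z) (x y : Fin (2*m)) :
    SameBlock π x y ↔ liftRel (absPart m π) (absMap m '' Z) f x y := by
  have hmem : ∀ z, absMap m z ∈ absMap m '' Z → z ∈ Z := by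
    rintro z ⟨w, hw, hwz⟩
    rcases absMap_eq_iff.1 hwz with rfl | rfl
    · exact hw
    · rw [← hnZ]
      exact mem_negSet.2 hw
  have hf₁ : posLift f ∈ Z := hmem _ (by rwa [absMap_posLift])
  have hf₂ : negLift f ∈ Z := hmem _ (by rwa [absMap_negLift])
  have key : ∀ x y, SameBlock π x y → x ∉ Z → OnArc f x → ¬ OnArc f y → False := by
    rintro x y ⟨X, hX, hx, hy⟩ hxZ hfx hfy
    have hxf : x ≠ posLift f := fun e => hxZ (e ▸ hf₁)
    have hyf : y ≠ negLift f := fun e =>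
      hxZ (h.1.1.eq_of_mem hX hZ hy (e ▸ hf₂) ▸ hx)
    rw [ne_eq, Fin.ext_iff] at hxf hyf
    simp only [posLift, negLift] at hxf hyf
    simp only [OnArc] at hfx hfy
    by_cases hyx : y < x
    · have := h.1.2 X hX Z hZ y (posLift f) x (negLift f)
        (by simp only [Fin.lt_def, posLift] at *; omega)
        (by simp only [Fin.lt_def, posLift] at *; omega)
        (by simp only [Fin.lt_def, negLift] at *; omega) hy hx hf₁ hf₂
      exact hxZ (h.1.1.eq_of_mem hX hZ this hf₁ ▸ hx)
    · have := h.1.2 Z hZ X hX (posLift f) x (negLift f) y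
        (by simp only [Fin.lt_def, posLift] at *; omega)
        (by simp only [Fin.lt_def, negLift] at *; omega)
        (by simp only [Fin.lt_def, negLift] at *; omega) hf₁ hf₂ hx hy
      exact hxZ this
  have arc : ∀ x y, SameBlock π x y → x ∉ Z → (OnArc f x ↔ OnArc f y) := by
    intro x y hxy hx
    have hy : y ∉ Z := fun hy => hx ((h.1.1.sameBlock_iff hZ hy).1 hxy.symm)
    have h₁ := key x y hxy hx
    have h₂ := key y x hxy.symm hy
    tauto
  constructor
  · intro hxy
    refine ⟨(h.sameBlock_absPart x y).2 (Or.inl hxy), ?_⟩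
    by_cases hx : x ∈ Z
    · exact Or.inl ⟨x, hx, rfl⟩
    · exact Or.inr (arc x y hxy hx)
  · rintro ⟨hs, hF⟩
    have hs' := (h.sameBlock_absPart x y).1 hs
    rcases hF with hF | hF
    · have hy := (h.isPartition_absPart.sameBlock_iff ⟨Z, hZ, rfl⟩ hF).1 hs
      exact ⟨Z, hZ, hmem x hF, hmem y hy⟩
    · by_cases hx : x ∈ Z
      · have hy := (h.isPartition_absPart.sameBlock_iff ⟨Z, hZ, rfl⟩ ⟨x, hx, rfl⟩).1 hs
        exact ⟨Z, hZ, hx, hmem y hy⟩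
      · refine hs'.resolve_right fun hn => ?_
        have := arc x _ hn hx
        rw [onArc_negMap] at this
        tauto

theorem NCBPart.eq_classesOf_liftRel {π : Set (Set (Fin (2*m)))} (h : NCBPart m π)
    {Z : Set (Fin (2*m))} (hZ : Z ∈ π) (hnZ : negSet m Z = Z) {f : Fin m}
    (hf : f ∈ absMap m '' Z) :
    π = classesOf (liftRel (absPart m π) (absMap m '' Z) f) := by
  have hr := equivalence_liftRel h.isPartition_absPart ⟨Z, hZ, rfl⟩ f
  refine h.1.1.ext_sameBlock (isPartition_classesOf hr) fun x y => ?_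
  rw [sameBlock_classesOf hr, h.sameBlock_iff_liftRel hZ hnZ hf]

theorem eq_preimage_absMap {Z : Set (Fin (2*m))} (hnZ : negSet m Z = Z) :
    Z = absMap m ⁻¹' (absMap m '' Z) := by
  refine (Set.subset_preimage_image _ _).antisymm ?_
  rintro z ⟨w, hw, hwz⟩
  rcases absMap_eq_iff.1 hwz with rfl | rfl
  · exact hw
  · rw [← hnZ]
    exact mem_negSet.2 hw

theorem absMap_surjective : Function.Surjective (absMap m) :=
  fun u => ⟨posLift u, absMap_posLift u⟩

theorem negSet_preimage_absMap (F : Set (Fin m)) :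
    negSet m (absMap m ⁻¹' F) = absMap m ⁻¹' F := by
  ext x
  rw [mem_negSet, Set.mem_preimage, absMap_negMap, Set.mem_preimage]

/-- The cyclic form of the non-crossing condition. -/
theorem NCPart.sameBlock_cyclic {p : Set (Set (Fin m))} (hp : NCPart p) {a b c d : Fin m}
    (h : (a < b ∧ b < c ∧ c < d) ∨ (b < c ∧ c < d ∧ d < a) ∨ (c < d ∧ d < a ∧ a < b) ∨
      (d < a ∧ a < b ∧ b < c))
    (hac : SameBlock p a c) (hbd : SameBlock p b d) : SameBlock p a b := by
  have nc := hp.1.isNC_iff.1 hp.2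
  have tr := @IsPartition.sameBlock_trans _ p hp.1
  rcases h with h | h | h | h
  · exact nc a b c d h.1 h.2.1 h.2.2 hac hbd
  · exact tr hac (nc b c d a h.1 h.2.1 h.2.2 hbd hac.symm).symm
  · exact tr hac (tr (nc c d a b h.1 h.2.1 h.2.2 hac.symm hbd.symm) hbd.symm)
  · exact tr (nc d a b c h.1 h.2.1 h.2.2 hbd.symm hac).symm hbd.symm

theorem nCPart_classesOf_liftRel {p : Set (Set (Fin m))} (hp : NCPart p) {F : Set (Fin m)}
    (hF : F ∈ p) {f : Fin m} (hf : f ∈ F) : NCPart (classesOf (liftRel p F f)) := by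
  have hr := equivalence_liftRel hp.1 hF f
  refine ⟨isPartition_classesOf hr, (isPartition_classesOf hr).isNC_iff.2 ?_⟩
  intro x y z w hxy hyz hzw hxz hyw
  rw [sameBlock_classesOf hr] at *
  have hFm : ∀ u, SameBlock p f u ↔ u ∈ F := fun u => hp.1.sameBlock_iff hF hf
  have hne : ∀ x, absMap m x ∉ F → absMap m x ≠ f := fun x hx e => hx (e ▸ hf)
  obtain ⟨hxz, hxz'⟩ := hxz
  obtain ⟨hyw, hyw'⟩ := hyw
  have hval : ∀ x : Fin (2*m), ((absMap m x).val = x.val ∧ x.val < m) ∨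
      ((absMap m x).val + m = x.val ∧ m ≤ x.val) := by
    intro x
    obtain ⟨u, rfl | rfl⟩ := eq_posLift_or_negLift x
    · left; rw [absMap_posLift]; exact ⟨rfl, u.isLt⟩
    · right; rw [absMap_negLift]; exact ⟨rfl, by simp [negLift]⟩
  have vx := hval x
  have vy := hval y
  have vz := hval z
  have vw := hval w
  simp only [OnArc] at hxz' hyw'
  by_cases hx : absMap m x ∈ F
  · by_cases hy : absMap m y ∈ F
    · exact ⟨hp.1.sameBlock_trans ((hFm _).2 hx).symm ((hFm _).2 hy), Or.inl hx⟩
    · exfalso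
      have hz := (hp.1.sameBlock_iff hF hx).1 hxz
      have e₁ := hne y hy
      have hw : absMap m w ∉ F := fun hw => hy ((hp.1.sameBlock_iff hF hw).1 hyw.symm)
      have e₂ := hne w hw
      have hyw'' := hyw'.resolve_left hy
      rw [ne_eq, Fin.ext_iff] at e₁ e₂
      have hfz := (hFm _).2 hz
      have hfx := (hFm _).2 hx
      have n₁ : ¬ SameBlock p f (absMap m y) := fun h => hy ((hFm _).1 h)
      have n₂ : ¬ SameBlock p f (absMap m w) := fun h => hw ((hFm _).1 h)
      rw [Fin.lt_def] at hxy hyz hzw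
      clear hFm hne hval hyw'
      by_cases hfy : f.val ≤ y.val ∨ w.val < f.val
      · refine n₁ (hp.sameBlock_cyclic ?_ hfz hyw)
        simp only [Fin.lt_def]
        omega
      · refine n₂ (hp.sameBlock_cyclic ?_ hfx hyw.symm)
        simp only [Fin.lt_def]
        omega
  · by_cases hy : absMap m y ∈ F
    · exfalso
      have hw := (hp.1.sameBlock_iff hF hy).1 hyw
      have e₁ := hne x hx
      have hz : absMap m z ∉ F := fun hz => hx ((hp.1.sameBlock_iff hF hz).1 hxz.symm)
      have e₂ := hne z hz
      have hxz'' := hxz'.resolve_left hx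
      rw [ne_eq, Fin.ext_iff] at e₁ e₂
      have hfw := (hFm _).2 hw
      have hfy := (hFm _).2 hy
      have n₁ : ¬ SameBlock p f (absMap m x) := fun h => hx ((hFm _).1 h)
      have n₂ : ¬ SameBlock p f (absMap m z) := fun h => hz ((hFm _).1 h)
      rw [Fin.lt_def] at hxy hyz hzw
      clear hFm hne hval hxz'
      by_cases hfx : f.val ≤ x.val ∨ z.val < f.val
      · refine n₁ (hp.sameBlock_cyclic ?_ hfy hxz)
        simp only [Fin.lt_def]
        omega
      · refine n₂ (hp.sameBlock_cyclic ?_ hfw hxz.symm)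
        simp only [Fin.lt_def]
        omega
    · have hxz'' := hxz'.resolve_left hx
      have hyw'' := hyw'.resolve_left hy
      rw [Fin.lt_def] at hxy hyz hzw
      clear hFm hne hval hxz' hyw'
      have hxy' : (f.val ≤ x.val ∧ x.val < f.val + m) ↔ (f.val ≤ y.val ∧ y.val < f.val + m) := by
        clear vx vy vz vw
        omega
      refine ⟨hp.sameBlock_cyclic ?_ hxz hyw, Or.inr hxy'⟩
      simp only [Fin.lt_def]
      clear hxz hyw
      by_cases hfx : f.val ≤ x.val ∧ x.val < f.val + m
      · have hy' := hxy'.1 hfx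
        have hz' := hxz''.1 hfx
        have hw' := hyw''.1 hy'
        clear hxz'' hyw'' hxy'
        rcases vx with vx | vx <;> rcases vy with vy | vy <;> rcases vz with vz | vz <;>
          rcases vw with vw | vw <;> omega
      · have hy' := (not_congr hxy').1 hfx
        have hz' := (not_congr hxz'').1 hfx
        have hw' := (not_congr hyw'').1 hy'
        clear hxz'' hyw'' hxy'
        rcases vx with vx | vx <;> rcases vy with vy | vy <;> rcases vz with vz | vz <;>
          rcases vw with vw | vw <;> omega

theorem nCBPart_classesOf_liftRel {p : Set (Set (Fin m))} (hp : NCPart p) {F : Set (Fin m)}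
    (hF : F ∈ p) {f : Fin m} (hf : f ∈ F) : NCBPart m (classesOf (liftRel p F f)) := by
  refine ⟨nCPart_classesOf_liftRel hp hF hf, ?_⟩
  rintro _ ⟨x, rfl⟩
  refine ⟨negMap m x, ?_⟩
  ext y
  rw [mem_negSet]
  simp only [Set.mem_ofPred_eq, liftRel, absMap_negMap, onArc_negMap]
  tauto

theorem preimage_mem_classesOf_liftRel {p : Set (Set (Fin m))} (hp : NCPart p) {F : Set (Fin m)}
    (hF : F ∈ p) {f : Fin m} (hf : f ∈ F) : absMap m ⁻¹' F ∈ classesOf (liftRel p F f) := by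
  refine ⟨posLift f, ?_⟩
  ext y
  simp only [Set.mem_preimage, Set.mem_ofPred_eq, liftRel, absMap_posLift, hf, true_or, and_true]
  exact (hp.1.sameBlock_iff hF hf).symm

theorem absPart_classesOf_liftRel {p : Set (Set (Fin m))} (hp : NCPart p) {F : Set (Fin m)}
    (hF : F ∈ p) {f : Fin m} (hf : f ∈ F) : absPart m (classesOf (liftRel p F f)) = p := by
  have h := nCBPart_classesOf_liftRel hp hF hf
  have hr := equivalence_liftRel hp.1 hF f
  refine h.isPartition_absPart.ext_sameBlock hp.1 fun u v => ?_
  have := onArc_negMap f (posLift v)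
  rw [negMap_posLift] at this
  rw [h.sameBlock_absPart_posLift, sameBlock_classesOf hr, sameBlock_classesOf hr]
  simp only [liftRel, absMap_posLift, absMap_negLift, this]
  tauto

theorem ncard_preimage_absMap (F : Set (Fin m)) : (absMap m ⁻¹' F).ncard = 2 * F.ncard := by
  have : absMap m ⁻¹' F = posLift '' F ∪ negLift '' F := by
    ext x
    obtain ⟨u, rfl | rfl⟩ := eq_posLift_or_negLift x
    · constructor
      · intro h
        rw [Set.mem_preimage, absMap_posLift] at h
        exact Or.inl ⟨u, h, rfl⟩
      · rintro (⟨v, hv, e⟩ | ⟨v, hv, e⟩) <;> rw [← e] <;>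
          simpa [absMap_posLift, absMap_negLift] using hv
    · constructor
      · intro h
        rw [Set.mem_preimage, absMap_negLift] at h
        exact Or.inr ⟨u, h, rfl⟩
      · rintro (⟨v, hv, e⟩ | ⟨v, hv, e⟩) <;> rw [← e] <;>
          simpa [absMap_posLift, absMap_negLift] using hv
  rw [this, Set.ncard_union_eq, Set.ncard_image_of_injective, Set.ncard_image_of_injective,
    two_mul]
  · exact (Function.LeftInverse.injective (g := absMap m) absMap_negLift)
  · exact (Function.LeftInverse.injective (g := absMap m) absMap_posLift)
  · rw [Set.disjoint_left]
    rintro _ ⟨u, -, rfl⟩ ⟨v, -, e⟩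
    rw [Fin.ext_iff] at e
    simp only [posLift, negLift] at e
    omega

theorem isRep_or_isRep_negSet {X : Set (Fin (2*m))} (hX : X.Nonempty) :
    IsRep m X ∨ IsRep m (negSet m X) := by
  have hfin : (X ∪ negSet m X).Finite := Set.toFinite _
  obtain ⟨x, hx⟩ := hfin.exists_minimal (hX.mono Set.subset_union_left)
  have hl : IsLeast (X ∪ negSet m X) x := by
    refine ⟨hx.1, fun y hy => ?_⟩
    rcases le_total x y with h | h
    · exact h
    · exact hx.2 hy h
  rcases hx.1 with h | h
  · exact Or.inl ⟨x, hl, h⟩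
  · refine Or.inr ⟨x, ?_, h⟩
    rwa [negSet_negSet, Set.union_comm]

theorem NCBPart.eq_of_negSet_eq {π : Set (Set (Fin (2*m)))} (h : NCBPart m π)
    {X Z : Set (Fin (2*m))} (hX : X ∈ π) (hZ : Z ∈ π) (hnX : negSet m X = X)
    (hnZ : negSet m Z = Z) : X = Z := by
  have key : ∀ Y ∈ π, negSet m Y = Y → ∃ u, posLift u ∈ Y ∧ negLift u ∈ Y := by
    intro Y hY hnY
    obtain ⟨y, hy⟩ := h.1.1.1 Y hY
    have hy' : negMap m y ∈ Y := mem_negSet.1 (hnY.symm ▸ hy)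
    obtain ⟨u, rfl | rfl⟩ := eq_posLift_or_negLift y
    · exact ⟨u, hy, by rwa [negMap_posLift] at hy'⟩
    · exact ⟨u, by rwa [negMap_negLift] at hy', hy⟩
  have lt : ∀ (X Z) (_ : X ∈ π) (_ : Z ∈ π) (u v : Fin m), posLift u ∈ X → negLift u ∈ X →
      posLift v ∈ Z → negLift v ∈ Z → u < v → X = Z := by
    intro X Z hX hZ u v hu hu' hv hv' huv
    refine h.1.1.eq_of_mem hX hZ (h.1.2 X hX Z hZ (posLift u) (posLift v) (negLift u)
      (negLift v) (by simpa [posLift] using huv) ?_ (by simpa [negLift] using huv)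
      hu hu' hv hv') hv
    simp only [posLift, negLift, Fin.lt_def]
    omega
  obtain ⟨u, hu, hu'⟩ := key X hX hnX
  obtain ⟨v, hv, hv'⟩ := key Z hZ hnZ
  rcases lt_trichotomy u v with huv | rfl | huv
  · exact lt X Z hX hZ u v hu hu' hv hv' huv
  · exact h.1.1.eq_of_mem hX hZ hu hv
  · exact (lt Z X hZ hX v u hv hv' hu hu' huv).symm

theorem ncard_image_absMap {π : Set (Set (Fin (2*m)))} (h : NCBPart m π)
    {X : Set (Fin (2*m))} (hX : X ∈ π) (hnX : negSet m X ≠ X) :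
    (absMap m '' X).ncard = X.ncard := by
  refine Set.InjOn.ncard_image fun x hx y hy e => ?_
  refine (absMap_eq_iff.1 e).resolve_right fun e' => hnX ?_
  exact h.1.1.eq_of_mem (h.2 X hX) hX (mem_negSet.2 (e' ▸ hx)) hy

/-- The absolute value map induces a bijection from representatives of the pairs of
non-zero-blocks onto the blocks that do not lie under the zero-block. -/
theorem NCBPart.bijOn_absMap {π : Set (Set (Fin (2*m)))} (h : NCBPart m π)
    {Z : Set (Fin (2*m))} (hZ : Z ∈ π) (hnZ : negSet m Z = Z) :
    Set.BijOn (fun X => absMap m '' X) {X | X ∈ π ∧ negSet m X ≠ X ∧ IsRep m X}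
      (absPart m π \ {absMap m '' Z}) := by
  have hne : ∀ X ∈ π, (absMap m '' X).Nonempty := fun X hX => (h.1.1.1 X hX).image _
  have habs : ∀ X ∈ π, ∀ Y ∈ π, absMap m '' X = absMap m '' Y → X = Y ∨ X = negSet m Y := by
    intro X hX Y hY e
    obtain ⟨u, hu⟩ := hne X hX
    exact h.eq_or_eq_negSet hX hY hu (e ▸ hu)
  refine ⟨?_, ?_, ?_⟩
  · rintro X ⟨hX, hnX, -⟩
    refine ⟨⟨X, hX, rfl⟩, fun e => hnX ?_⟩
    have := habs X hX Z hZ e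
    rw [hnZ, or_self] at this
    rw [this, hnZ]
  · rintro X ⟨hX, hnX, x, hx, hxX⟩ Y ⟨hY, hnY, y, hy, hyY⟩ e
    refine (habs X hX Y hY e).resolve_right fun e' => ?_
    subst e'
    rw [negSet_negSet, Set.union_comm] at hx
    rw [hx.unique hy] at hxX
    exact hnY (h.1.1.eq_of_mem hX hY hxX hyY)
  · rintro _ ⟨⟨X, hX, rfl⟩, hXZ⟩
    have hnX : negSet m X ≠ X := by
      intro e
      rw [h.eq_of_negSet_eq hX hZ e hnZ] at hXZ
      exact hXZ rfl
    rcases isRep_or_isRep_negSet (h.1.1.1 X hX) with hrep | hrep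
    · exact ⟨X, ⟨hX, hnX, hrep⟩, rfl⟩
    · refine ⟨negSet m X, ⟨h.2 X hX, ?_, hrep⟩, absMap_image_negSet X⟩
      rw [negSet_negSet]
      exact hnX.symm

end TypeB

end NCPB

namespace NCPB

theorem fst_prod {ι : Type*} (s : Finset ι) (g : ι → DualNumber ℂ) :
    (∏ i ∈ s, g i).fst = ∏ i ∈ s, (g i).fst :=
  map_prod (TrivSqZeroExt.fstHom ℂ ℂ ℂ) g s

theorem snd_prod {ι : Type*} [DecidableEq ι] (s : Finset ι) (g : ι → DualNumber ℂ) :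
    (∏ i ∈ s, g i).snd = ∑ i ∈ s, (∏ j ∈ s.erase i, (g j).fst) * (g i).snd := by
  induction s using Finset.induction_on with
  | empty => simp
  | insert a s ha ih =>
    rw [Finset.prod_insert ha, TrivSqZeroExt.snd_mul, ih, fst_prod, Finset.sum_insert ha,
      Finset.erase_insert ha, smul_eq_mul, op_smul_eq_smul, smul_eq_mul, add_comm,
      mul_comm, Finset.mul_sum]
    rw [mul_comm]
    congr 1
    refine Finset.sum_congr rfl fun i hi => ?_
    have hne : a ≠ i := fun e => ha (e ▸ hi)
    rw [Finset.erase_insert_of_ne hne, Finset.prod_insert (fun h => ha (Finset.mem_of_mem_erase h)),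
      mul_assoc]

theorem gammaFst_one (a' : ℕ → ℂ) (m : ℕ) :
    gammaFst a' (fun _ => 1) m =
      ∑ p : Set (Set (Fin m)) with NCPart p, ∏ F ∈ p.toFinset, a' F.ncard := by
  simp only [gammaFst, finprod_mem_one, mul_one, finsum_eq_sum_of_fintype, finsum_eq_if]
  rw [← Finset.sum_filter]
  refine Finset.sum_bij (fun pq _ => pq.1) ?_ ?_ ?_ ?_
  · intro pq h
    simp only [Finset.mem_filter, Finset.mem_univ, true_and] at h ⊢
    exact h.1
  · rintro ⟨p, q⟩ h ⟨p', q'⟩ h' e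
    simp only [Finset.mem_filter, Finset.mem_univ, true_and] at h h' e
    subst e
    rw [(isKr_iff h.1).1 h.2, (isKr_iff h.1).1 h'.2]
  · intro p hp
    simp only [Finset.mem_filter, Finset.mem_univ, true_and] at hp
    exact ⟨(p, _), by simpa using ⟨hp, (isKr_iff hp).2 rfl⟩, rfl⟩
  · intro pq h
    rw [finprod_mem_eq_toFinset_prod]

theorem gammaSnd_one_zero (a' a'' : ℕ → ℂ) (m : ℕ) :
    gammaSnd a' a'' (fun _ => 1) (fun _ => 0) m =
      ∑ p : Set (Set (Fin m)) with NCPart p, ∑ F ∈ p.toFinset,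
        (∏ G ∈ p.toFinset.erase F, a' G.ncard) * a'' F.ncard := by
  simp only [gammaSnd, finprod_mem_one, mul_one, mul_zero, finsum_zero, add_zero]
  simp only [finsum_eq_sum_of_fintype, finsum_eq_if]
  rw [← Finset.sum_filter, Finset.sum_sigma']
  refine Finset.sum_bij (fun t _ => ⟨absPart m t.1.1, absMap m '' t.2⟩) ?_ ?_ ?_ ?_
  · rintro ⟨⟨π, q⟩, Z⟩ h
    simp only [Finset.mem_filter, Finset.mem_univ, true_and, Finset.mem_sigma,
      Set.mem_toFinset] at h ⊢
    exact ⟨h.1.nCPart_absPart, ⟨Z, h.2.2.1, rfl⟩⟩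
  · rintro ⟨⟨π, q⟩, Z⟩ h ⟨⟨π', q'⟩, Z'⟩ h' e
    simp only [Finset.mem_filter, Finset.mem_univ, true_and] at h h'
    obtain ⟨h, hq, hZ, hnZ⟩ := h
    obtain ⟨h', hq', hZ', hnZ'⟩ := h'
    simp only [Sigma.mk.injEq, heq_eq_eq] at e
    obtain ⟨e₁, e₂⟩ := e
    obtain ⟨z, hz⟩ := h.1.1.1 Z hZ
    have hf : absMap m z ∈ absMap m '' Z := ⟨z, hz, rfl⟩
    have hπ : π = π' := by
      rw [h.eq_classesOf_liftRel hZ hnZ hf, h'.eq_classesOf_liftRel hZ' hnZ' (e₂ ▸ hf), e₁, e₂]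
    subst hπ
    rw [(isKr_iff h.1).1 hq, (isKr_iff h.1).1 hq', h.eq_of_negSet_eq hZ hZ' hnZ hnZ']
  · rintro ⟨p, F⟩ hp
    simp only [Finset.mem_filter, Finset.mem_univ, true_and, Finset.mem_sigma,
      Set.mem_toFinset] at hp
    obtain ⟨hp, hF⟩ := hp
    obtain ⟨f, hf⟩ := hp.1.1 F hF
    have h := nCBPart_classesOf_liftRel hp hF hf
    refine ⟨((classesOf (liftRel p F f), classesOf (krRel (classesOf (liftRel p F f)))),
      absMap m ⁻¹' F), ?_, ?_⟩
    · simp only [Finset.mem_filter, Finset.mem_univ, true_and]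
      exact ⟨h, (isKr_iff h.1).2 rfl, preimage_mem_classesOf_liftRel hp hF hf,
        negSet_preimage_absMap F⟩
    · simp only [absPart_classesOf_liftRel hp hF hf,
        Set.image_preimage_eq F absMap_surjective]
  · rintro ⟨⟨π, q⟩, Z⟩ h
    simp only [Finset.mem_filter, Finset.mem_univ, true_and] at h
    obtain ⟨h, -, hZ, hnZ⟩ := h
    have hcard : Z.ncard / 2 = (absMap m '' Z).ncard := by
      conv_lhs => rw [eq_preimage_absMap hnZ, ncard_preimage_absMap]
      omega
    have hprod := finprod_mem_eq_of_bijOn (f := fun X => a' X.ncard) (g := fun G => a' G.ncard)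
      _ (h.bijOn_absMap hZ hnZ) fun X hX => by rw [ncard_image_absMap h hX.1 hX.2.1]
    rw [hcard, hprod, finprod_mem_eq_toFinset_prod]
    congr 2
    ext G
    simp [and_comm]

end NCPB
open NCPB TrivSqZeroExt in
/-- For `(a, ξ)` in a non-commutative probability space of type B,
the moment series `M` and the R-transform `R` (series encoded by their coefficient
functions, index `k` holding the coefficient of `z^(k+1)`) satisfy `M = R ⊛^B ζ'`,
where `ζ'` is the series all of whose coefficients are `(1,0)`. -/
theorem moment_series_eq_Rtransform_boxedB_zeta
    (A : Type*) [Ring A] [Algebra ℂ A]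
    (V : Type*) [AddCommGroup V] [Module ℂ V]
    [Module A V] [Module Aᵐᵒᵖ V] [SMulCommClass A Aᵐᵒᵖ V]
    (φ : A →ₗ[ℂ] ℂ) (hφ1 : φ 1 = 1) (f : V →ₗ[ℂ] ℂ)
    (κB : (m : ℕ) → (Fin m → TrivSqZeroExt A V) → DualNumber ℂ)
    (hB : MomCumB A V φ f κB)
    (a : A) (ξ : V)
    (M R : ℕ → DualNumber ℂ)
    (hM : ∀ k, M k = expB A V φ f ((inl a + inr ξ : TrivSqZeroExt A V) ^ (k+1)))
    (hR : ∀ k, R k = κB (k+1) (fun _ => inl a + inr ξ)) :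
    M = boxedB R (fun _ => 1) := by
  have hκ : ∀ n, n ≠ 0 → κB n (fun _ => inl a + inr ξ) = R (n - 1) := by
    intro n hn
    obtain ⟨k, rfl⟩ := Nat.exists_eq_succ_of_ne_zero hn
    rw [Nat.succ_sub_one, hR]
  funext k
  have h := hB k (fun _ => inl a + inr ξ)
  rw [List.ofFn_const, List.prod_replicate, ← hM] at h
  simp only [finsum_eq_sum_of_fintype, finsum_eq_if, finprod_mem_eq_toFinset_prod] at h
  rw [← Finset.sum_filter] at h
  have hMk : M k = ∑ p : Set (Set (Fin (k+1))) with NCPart p,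
      ∏ F ∈ p.toFinset, R (F.ncard - 1) := by
    rw [← h]
    refine Finset.sum_congr rfl fun p hp => Finset.prod_congr rfl fun F hF => hκ _ ?_
    rw [Set.mem_toFinset] at hF
    exact Set.ncard_ne_zero_of_mem ((Finset.mem_filter.1 hp).2.1.1 F hF).some_mem
  rw [hMk]
  simp only [boxedB, fst_one, snd_one, gammaFst_one, gammaSnd_one_zero, mkD]
  ext
  · simp [fst_sum, fst_prod]
  · simp [snd_sum, snd_prod]
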